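/- (Main theorem: generators of the Eisenstein–Picard modular group in three complex dimensions.) Let G ∈ U(3,1) be a 4×4 matrix all of whose entries lie in Z[ω]. Then there exists λ ∈ ℂ with λ⁶ = 1 such that λ·G lies in the subgroup of GL(4,ℂ) generated by the four matrices N₁ (a Heisenberg translation), M_{U₁} and M_{U₂} (Heisenberg rotations), and the involution R. In other words, modulo unit scalar matrices, the Eisenstein–Picard modular group PU(3,1;Z[ω]) is generated by these four transformations. -/

import Mathlib

open Matrix Complex

/-- ω = (−1 + i√3)/2, a primitive cube root of unity. -/
noncomputable def ω : ℂ := (-1 + Complex.I * Real.sqrt 3) / 2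

/-- The Eisenstein integers Z[ω], as a subset of ℂ. -/
def Zω : Set ℂ := {z : ℂ | ∃ a b : ℤ, z = (a : ℂ) + (b : ℂ) * ω}

/-- The Hermitian form matrix J. -/
def Jm : Matrix (Fin 4) (Fin 4) ℂ := !![0,0,0,1; 0,1,0,0; 0,0,1,0; 1,0,0,0]

/-- Heisenberg translation N_(τ,t). -/
noncomputable def N (τ₁ τ₂ : ℂ) (t : ℝ) : Matrix (Fin 4) (Fin 4) ℂ :=
  !![1, -(starRingEnd ℂ) τ₁, -(starRingEnd ℂ) τ₂,
       (-((Complex.normSq τ₁ : ℂ) + (Complex.normSq τ₂ : ℂ)) + Complex.I * (t : ℝ)) / 2;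
     0, 1, 0, τ₁;
     0, 0, 1, τ₂;
     0, 0, 0, 1]

/-- Heisenberg rotation M_U = diag(1, U, 1). -/
def M (U : Matrix (Fin 2) (Fin 2) ℂ) : Matrix (Fin 4) (Fin 4) ℂ :=
  !![1, 0, 0, 0;
     0, U 0 0, U 0 1, 0;
     0, U 1 0, U 1 1, 0;
     0, 0, 0, 1]

/-- Heisenberg dilation A_r = diag(r, 1, 1, 1/r). -/
noncomputable def Ad (r : ℝ) : Matrix (Fin 4) (Fin 4) ℂ :=
  !![(r : ℂ), 0, 0, 0; 0, 1, 0, 0; 0, 0, 1, 0; 0, 0, 0, (r : ℂ)⁻¹]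

noncomputable def U₁ : Matrix (Fin 2) (Fin 2) ℂ := !![0, 1; 1, 0]
noncomputable def U₂ : Matrix (Fin 2) (Fin 2) ℂ := !![-ω, 0; 0, 1]

/-- The Heisenberg translation N₁ = N_((1,0)ᵀ, √3). -/
noncomputable def N₁ : Matrix (Fin 4) (Fin 4) ℂ := N 1 0 (Real.sqrt 3)

/-- The involution R. -/
def Rmat : Matrix (Fin 4) (Fin 4) ℂ := !![0,0,0,1; 0,-1,0,0; 0,0,-1,0; 1,0,0,0]

/-- The generators {N₁, M_{U₁}, M_{U₂}} of the stabilizer of ∞, as a subset of GL(4,ℂ). -/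
noncomputable def gens3 : Set (GL (Fin 4) ℂ) :=
  {g | (g : Matrix (Fin 4) (Fin 4) ℂ) = N₁ ∨ (g : Matrix (Fin 4) (Fin 4) ℂ) = M U₁ ∨
       (g : Matrix (Fin 4) (Fin 4) ℂ) = M U₂}

/-- The generators {U₁, U₂}, as a subset of GL(2,ℂ). -/
noncomputable def gens2 : Set (GL (Fin 2) ℂ) :=
  {g | (g : Matrix (Fin 2) (Fin 2) ℂ) = U₁ ∨ (g : Matrix (Fin 2) (Fin 2) ℂ) = U₂}

/-- The generators {N₁, M_{U₁}, M_{U₂}, R}, as a subset of GL(4,ℂ). -/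
noncomputable def gens4 : Set (GL (Fin 4) ℂ) :=
  {g | (g : Matrix (Fin 4) (Fin 4) ℂ) = N₁ ∨ (g : Matrix (Fin 4) (Fin 4) ℂ) = M U₁ ∨
       (g : Matrix (Fin 4) (Fin 4) ℂ) = M U₂ ∨ (g : Matrix (Fin 4) (Fin 4) ℂ) = Rmat}

open scoped ComplexConjugate

/-! ### Arithmetic of the Eisenstein integers -/

theorem omega_re : ω.re = -1 / 2 := by
  simp [ω]

theorem omega_im : ω.im = √3 / 2 := by
  simp [ω]

theorem sqrt_three_mul_self : √3 * √3 = 3 := Real.mul_self_sqrt (by norm_num)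

theorem omega_mul_self : ω * ω = -1 - ω := by
  apply Complex.ext <;> simp only [mul_re, mul_im, sub_re, sub_im, neg_re, neg_im, one_re, one_im,
    omega_re, omega_im] <;> nlinarith [sqrt_three_mul_self]

theorem conj_omega : conj ω = -1 - ω := by
  apply Complex.ext <;> simp only [conj_re, conj_im, sub_re, sub_im, neg_re, neg_im, one_re,
    one_im, omega_re, omega_im] <;> ring

/-- The Eisenstein integers as a subring of `ℂ`. -/
noncomputable def eisenstein : Subring ℂ where
  carrier := Zω
  mul_mem' := by
    rintro _ _ ⟨a, b, rfl⟩ ⟨c, d, rfl⟩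
    refine ⟨a * c - b * d, a * d + b * c - b * d, ?_⟩
    push_cast
    linear_combination (b * d : ℂ) * omega_mul_self
  one_mem' := ⟨1, 0, by simp⟩
  add_mem' := by
    rintro _ _ ⟨a, b, rfl⟩ ⟨c, d, rfl⟩
    exact ⟨a + c, b + d, by push_cast; ring⟩
  zero_mem' := ⟨0, 0, by simp⟩
  neg_mem' := by
    rintro _ ⟨a, b, rfl⟩
    exact ⟨-a, -b, by push_cast; ring⟩

theorem omega_mem_eisenstein : ω ∈ eisenstein := ⟨0, 1, by simp⟩

theorem conj_mem_eisenstein {z : ℂ} (hz : z ∈ eisenstein) : conj z ∈ eisenstein := by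
  obtain ⟨a, b, rfl⟩ := hz
  refine ⟨a - b, -b, ?_⟩
  simp only [map_add, map_mul, conj_omega, map_intCast]
  push_cast
  ring

theorem normSq_int_add_int_mul_omega (a b : ℤ) :
    normSq ((a : ℂ) + (b : ℂ) * ω) = ((a ^ 2 - a * b + b ^ 2 : ℤ) : ℝ) := by
  simp only [normSq_apply, add_re, add_im, mul_re, mul_im, intCast_re, intCast_im, omega_re,
    omega_im]
  push_cast
  linear_combination (b ^ 2 / 4 : ℝ) * sqrt_three_mul_self

theorem exists_nat_normSq_eq {z : ℂ} (hz : z ∈ eisenstein) : ∃ n : ℕ, normSq z = n := by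
  obtain ⟨a, b, rfl⟩ := hz
  have h : 0 ≤ a ^ 2 - a * b + b ^ 2 := by nlinarith [sq_nonneg (a - b), sq_nonneg a, sq_nonneg b]
  obtain ⟨n, hn⟩ := Int.eq_ofNat_of_zero_le h
  exact ⟨n, by rw [normSq_int_add_int_mul_omega, hn]; simp⟩

theorem neg_omega_pow_six : (-ω) ^ 6 = 1 := by
  have h : (-ω) ^ 3 = -1 := by
    linear_combination (-ω + 1) * omega_mul_self
  calc (-ω) ^ 6 = ((-ω) ^ 3) ^ 2 := by ring
    _ = 1 := by rw [h]; norm_num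

theorem exists_eq_neg_omega_pow {u : ℂ} (hu : u ∈ eisenstein) (h : normSq u = 1) :
    ∃ k : ℕ, u = (-ω) ^ k := by
  obtain ⟨a, b, rfl⟩ := hu
  rw [normSq_int_add_int_mul_omega] at h
  have h' : a ^ 2 - a * b + b ^ 2 = 1 := by exact_mod_cast h
  have ha₁ : a ≤ 1 := by nlinarith [sq_nonneg (2 * b - a)]
  have ha₂ : -1 ≤ a := by nlinarith [sq_nonneg (2 * b - a)]
  have hb₁ : b ≤ 1 := by nlinarith [sq_nonneg (2 * a - b)]
  have hb₂ : -1 ≤ b := by nlinarith [sq_nonneg (2 * a - b)]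
  have h₂ : (-ω) ^ 2 = -1 - ω := by linear_combination omega_mul_self
  have h₃ : (-ω) ^ 3 = -1 := by linear_combination (-ω + 1) * omega_mul_self
  have h₄ : (-ω) ^ 4 = ω := by linear_combination (-ω) * h₃
  have h₅ : (-ω) ^ 5 = 1 + ω := by linear_combination (-ω) * h₄ - omega_mul_self
  interval_cases a <;> interval_cases b <;> norm_num at h'
  · exact ⟨2, by rw [h₂]; push_cast; ring⟩
  · exact ⟨3, by rw [h₃]; push_cast; ring⟩
  · exact ⟨1, by push_cast; ring⟩
  · exact ⟨4, by rw [h₄]; push_cast; ring⟩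
  · exact ⟨0, by push_cast; ring⟩
  · exact ⟨5, by rw [h₅]; push_cast; ring⟩

theorem normSq_eq_zero_or_one {z w : ℂ} (hz : z ∈ eisenstein) (hw : w ∈ eisenstein)
    (h : normSq z + normSq w = 1) : z = 0 ∧ normSq w = 1 ∨ normSq z = 1 ∧ w = 0 := by
  obtain ⟨m, hm⟩ := exists_nat_normSq_eq hz
  obtain ⟨n, hn⟩ := exists_nat_normSq_eq hw
  rw [hm, hn] at h
  have h' : m + n = 1 := by exact_mod_cast h
  rw [← normSq_eq_zero (z := z), ← normSq_eq_zero (z := w), hm, hn]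
  norm_cast
  omega

theorem eq_zsmul_of_add_conj_eq_zero {z : ℂ} (hz : z ∈ eisenstein) (h : z + conj z = 0) :
    ∃ k : ℤ, z = k • (2 * ω + 1) := by
  obtain ⟨a, b, rfl⟩ := hz
  refine ⟨a, ?_⟩
  simp only [map_add, map_mul, conj_omega, map_intCast] at h
  rw [zsmul_eq_mul]
  linear_combination (-ω) * h

theorem exists_normSq_add_le (w : ℂ) : ∃ τ ∈ eisenstein, normSq (w + τ) ≤ 7 / 16 := by
  set n : ℤ := round (w.im * (2 / √3)) with hn
  set m : ℤ := round (w.re + n / 2) with hm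
  have h₃ : 0 < √3 := by positivity
  refine ⟨(-m : ℤ) + (-n : ℤ) * ω, ⟨-m, -n, rfl⟩, ?_⟩
  have hb : |w.im * (2 / √3) - n| ≤ 1 / 2 := abs_sub_round _
  have ha : |w.re + n / 2 - m| ≤ 1 / 2 := abs_sub_round _
  have hre : (w + ((-m : ℤ) + (-n : ℤ) * ω)).re = w.re + n / 2 - m := by
    simp [omega_re]; ring
  have him : (w + ((-m : ℤ) + (-n : ℤ) * ω)).im = (w.im * (2 / √3) - n) * (√3 / 2) := by
    simp [omega_im]; field_simp; ring
  rw [normSq_apply, hre, him]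
  have ha' := sq_le_sq' (abs_le.1 ha).1 (abs_le.1 ha).2
  have hb' := sq_le_sq' (abs_le.1 hb).1 (abs_le.1 hb).2
  nlinarith [sqrt_three_mul_self]

theorem exists_normSq_add_zsmul_lt {w : ℂ} (hre : |w.re| ≤ 7 / 16) :
    ∃ k : ℤ, normSq (w + k • (2 * ω + 1)) < 1 := by
  have h₃ : 0 < √3 := by positivity
  refine ⟨-round (w.im / √3), ?_⟩
  set n : ℤ := round (w.im / √3) with hn
  have hb : |w.im / √3 - n| ≤ 1 / 2 := abs_sub_round _
  have hre' : (w + (-n : ℤ) • (2 * ω + 1)).re = w.re := by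
    simp [omega_re]
    ring
  have him : (w + (-n : ℤ) • (2 * ω + 1)).im = (w.im / √3 - n) * √3 := by
    simp [omega_im]; field_simp; ring
  rw [normSq_apply, hre', him]
  have ha' := sq_le_sq' (abs_le.1 hre).1 (abs_le.1 hre).2
  have hb' := sq_le_sq' (abs_le.1 hb).1 (abs_le.1 hb).2
  nlinarith [sqrt_three_mul_self]

/-! ### Matrices of the Eisenstein–Picard modular group -/

/-- `A` belongs to `U(3,1; Z[ω])`. -/
def IsPicard (A : Matrix (Fin 4) (Fin 4) ℂ) : Prop :=
  Aᴴ * Jm * A = Jm ∧ ∀ i j, A i j ∈ eisenstein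

theorem Jm_mul_self : Jm * Jm = 1 := by
  ext i j
  fin_cases i <;> fin_cases j <;> simp [Jm, Matrix.mul_apply, Fin.sum_univ_four]

theorem Jm_mem_eisenstein (i j : Fin 4) : Jm i j ∈ eisenstein := by
  fin_cases i <;> fin_cases j <;> simp [Jm, eisenstein.zero_mem, eisenstein.one_mem]

theorem mul_apply_mem_eisenstein {A B : Matrix (Fin 4) (Fin 4) ℂ}
    (hA : ∀ i j, A i j ∈ eisenstein) (hB : ∀ i j, B i j ∈ eisenstein) (i j : Fin 4) :
    (A * B) i j ∈ eisenstein := by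
  rw [Matrix.mul_apply]
  exact sum_mem fun k _ => mul_mem (hA i k) (hB k j)

theorem IsPicard.one : IsPicard 1 := by
  refine ⟨by simp, fun i j => ?_⟩
  rw [Matrix.one_apply]
  split_ifs
  exacts [eisenstein.one_mem, eisenstein.zero_mem]

theorem IsPicard.mul {A B : Matrix (Fin 4) (Fin 4) ℂ} (hA : IsPicard A) (hB : IsPicard B) :
    IsPicard (A * B) := by
  refine ⟨?_, mul_apply_mem_eisenstein hA.2 hB.2⟩
  calc (A * B)ᴴ * Jm * (A * B) = Bᴴ * (Aᴴ * Jm * A) * B := by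
        simp only [conjTranspose_mul, Matrix.mul_assoc]
    _ = Jm := by rw [hA.1, hB.1]

theorem IsPicard.of_mul_eq_one {A B : Matrix (Fin 4) (Fin 4) ℂ} (hA : IsPicard A)
    (h : A * B = 1) : IsPicard B := by
  have hB : B = Jm * Aᴴ * Jm := by
    calc B = Jm * Jm * B := by rw [Jm_mul_self, Matrix.one_mul]
      _ = Jm * (Aᴴ * Jm * A) * B := by rw [hA.1]
      _ = Jm * Aᴴ * Jm * (A * B) := by simp only [Matrix.mul_assoc]
      _ = Jm * Aᴴ * Jm := by rw [h, Matrix.mul_one]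
  constructor
  · calc Bᴴ * Jm * B = Bᴴ * (Aᴴ * Jm * A) * B := by rw [hA.1]
      _ = (A * B)ᴴ * Jm * (A * B) := by simp only [conjTranspose_mul, Matrix.mul_assoc]
      _ = Jm := by simp [h]
  · rw [hB]
    exact mul_apply_mem_eisenstein (mul_apply_mem_eisenstein Jm_mem_eisenstein
      fun i j => conj_mem_eisenstein (hA.2 j i)) Jm_mem_eisenstein

theorem IsPicard.smul {A : Matrix (Fin 4) (Fin 4) ℂ} (hA : IsPicard A) {u : ℂ}
    (hu : u ∈ eisenstein) (h : conj u * u = 1) : IsPicard (u • A) := by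
  refine ⟨?_, fun i j => mul_mem hu (hA.2 i j)⟩
  rw [conjTranspose_smul, Matrix.smul_mul, Matrix.smul_mul, Matrix.mul_smul, hA.1, smul_smul,
    ← starRingEnd_apply, h, one_smul]

theorem IsPicard.form_apply {A : Matrix (Fin 4) (Fin 4) ℂ} (hA : IsPicard A) (i j : Fin 4) :
    conj (A 0 i) * A 3 j + conj (A 1 i) * A 1 j + conj (A 2 i) * A 2 j + conj (A 3 i) * A 0 j
      = Jm i j := by
  rw [← hA.1]
  simp [Matrix.mul_apply, Fin.sum_univ_four, Jm]
  ring

/-! ### The generated subgroup -/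

/-- `A` is a product of the four generators and their inverses. -/
def Generated (A : Matrix (Fin 4) (Fin 4) ℂ) : Prop :=
  ∃ g ∈ Subgroup.closure gens4, (g : Matrix (Fin 4) (Fin 4) ℂ) = A

theorem Generated.one : Generated 1 := ⟨1, one_mem _, rfl⟩

theorem Generated.mul {A B : Matrix (Fin 4) (Fin 4) ℂ} :
    Generated A → Generated B → Generated (A * B) := by
  rintro ⟨g, hg, rfl⟩ ⟨h, hh, rfl⟩
  exact ⟨g * h, mul_mem hg hh, rfl⟩

theorem Generated.of_mul_left {A B : Matrix (Fin 4) (Fin 4) ℂ} :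
    Generated A → Generated (A * B) → Generated B := by
  rintro ⟨g, hg, rfl⟩ ⟨h, hh, hgh⟩
  refine ⟨g⁻¹ * h, mul_mem (inv_mem hg) hh, ?_⟩
  rw [Units.val_mul, hgh, Units.inv_mul_cancel_left]

theorem Generated.of_mul_right {A B : Matrix (Fin 4) (Fin 4) ℂ} :
    Generated B → Generated (A * B) → Generated A := by
  rintro ⟨g, hg, rfl⟩ ⟨h, hh, hgh⟩
  refine ⟨h * g⁻¹, mul_mem hh (inv_mem hg), ?_⟩
  rw [Units.val_mul, hgh, Units.mul_inv_cancel_right]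

theorem generated_of_isUnit {A : Matrix (Fin 4) (Fin 4) ℂ} (hA : IsUnit A)
    (h : A = N₁ ∨ A = M U₁ ∨ A = M U₂ ∨ A = Rmat) : Generated A := by
  obtain ⟨g, rfl⟩ := hA
  exact ⟨g, Subgroup.subset_closure h, rfl⟩

/-- The upper unitriangular matrix with translation part `(a, b)` and corner entry `z`. -/
noncomputable def heis (a b z : ℂ) : Matrix (Fin 4) (Fin 4) ℂ :=
  !![1, -conj a, -conj b, z; 0, 1, 0, a; 0, 0, 1, b; 0, 0, 0, 1]

theorem heis_mul (a b z a' b' z' : ℂ) :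
    heis a b z * heis a' b' z' =
      heis (a + a') (b + b') (z + z' - conj a * a' - conj b * b') := by
  ext i j
  fin_cases i <;> fin_cases j <;> simp [heis, Matrix.mul_apply, Fin.sum_univ_four] <;> ring

theorem heis_zero : heis 0 0 0 = 1 := by
  ext i j
  fin_cases i <;> fin_cases j <;> simp [heis]

theorem M_mul (U V : Matrix (Fin 2) (Fin 2) ℂ) : M U * M V = M (U * V) := by
  ext i j
  fin_cases i <;> fin_cases j <;>
    simp [M, Matrix.mul_apply, Fin.sum_univ_four, Fin.sum_univ_two]

theorem M_one : M 1 = 1 := by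
  ext i j
  fin_cases i <;> fin_cases j <;> simp [M]

theorem N₁_eq_heis : N₁ = heis 1 0 ω := by
  simp only [N₁, N, heis, ω, map_one, map_zero]
  push_cast
  congr! 5
  ring_nf

theorem isUnit_heis (a b z : ℂ) : IsUnit (heis a b z) := by
  apply IsUnit.of_mul_eq_one (heis (-a) (-b) (-z - conj a * a - conj b * b))
  rw [heis_mul, ← heis_zero]
  congr 1 <;> ring

theorem U₁_mul_self : U₁ * U₁ = 1 := by
  ext i j
  fin_cases i <;> fin_cases j <;> simp [U₁]

theorem U₂_pow (k : ℕ) : U₂ ^ k = !![(-ω) ^ k, 0; 0, 1] := by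
  induction k with
  | zero => simp [Matrix.one_fin_two]
  | succ k ih => rw [pow_succ, ih]; simp [U₂, pow_succ]

theorem generated_M_U₁ : Generated (M U₁) :=
  generated_of_isUnit (IsUnit.of_mul_eq_one (M U₁) (by rw [M_mul, U₁_mul_self, M_one])) (by simp)

theorem generated_M_U₂ : Generated (M U₂) := by
  refine generated_of_isUnit (IsUnit.of_mul_eq_one (M (U₂ ^ 5)) ?_) (by simp)
  rw [M_mul, ← pow_succ', U₂_pow, neg_omega_pow_six, ← Matrix.one_fin_two, M_one]

theorem generated_heis_one : Generated (heis 1 0 ω) :=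
  N₁_eq_heis ▸ generated_of_isUnit (N₁_eq_heis ▸ isUnit_heis 1 0 ω) (by simp)

theorem Rmat_mul_self : Rmat * Rmat = 1 := by
  ext i j
  fin_cases i <;> fin_cases j <;> simp [Rmat, Matrix.mul_apply, Fin.sum_univ_four]

theorem generated_Rmat : Generated Rmat :=
  generated_of_isUnit (IsUnit.of_mul_eq_one Rmat Rmat_mul_self) (by simp)

theorem isPicard_N₁ : IsPicard N₁ := by
  rw [N₁_eq_heis]
  have h := eisenstein.zero_mem
  have h₁ := eisenstein.one_mem
  have h₂ := eisenstein.neg_mem h₁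
  constructor
  · ext i j
    fin_cases i <;> fin_cases j <;>
      simp [heis, Jm, Matrix.mul_apply, Fin.sum_univ_four, conj_omega]
    ring
  · intro i j
    fin_cases i <;> fin_cases j <;> simp [heis, h, h₁, h₂, omega_mem_eisenstein]

theorem isPicard_M_U₁ : IsPicard (M U₁) := by
  constructor
  · ext i j
    fin_cases i <;> fin_cases j <;> simp [M, U₁, Jm, Matrix.mul_apply, Fin.sum_univ_four]
  · intro i j
    fin_cases i <;> fin_cases j <;> simp [M, U₁, eisenstein.zero_mem, eisenstein.one_mem]

theorem isPicard_M_U₂ : IsPicard (M U₂) := by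
  constructor
  · ext i j
    fin_cases i <;> fin_cases j <;>
      simp [M, U₂, Jm, Matrix.mul_apply, Fin.sum_univ_four, conj_omega]
    linear_combination -omega_mul_self
  · intro i j
    fin_cases i <;> fin_cases j <;>
      simp [M, U₂, eisenstein.zero_mem, eisenstein.one_mem, omega_mem_eisenstein]

theorem isPicard_Rmat : IsPicard Rmat := by
  constructor
  · ext i j
    fin_cases i <;> fin_cases j <;> simp [Rmat, Jm, Matrix.mul_apply, Fin.sum_univ_four]
  · intro i j
    fin_cases i <;> fin_cases j <;> simp [Rmat, eisenstein.zero_mem, eisenstein.one_mem]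

theorem Generated.isPicard {A : Matrix (Fin 4) (Fin 4) ℂ} (hA : Generated A) : IsPicard A := by
  obtain ⟨g, hg, rfl⟩ := hA
  induction hg using Subgroup.closure_induction with
  | mem x hx =>
    rcases hx with h | h | h | h <;> rw [h]
    exacts [isPicard_N₁, isPicard_M_U₁, isPicard_M_U₂, isPicard_Rmat]
  | one => exact .one
  | mul x y _ _ hx hy => exact hx.mul hy
  | inv x _ hx => exact hx.of_mul_eq_one (Units.mul_inv x)

/-! ### Rotations and translations -/

theorem generated_M_diagonal {u v : ℂ} (hu : u ∈ eisenstein) (hv : v ∈ eisenstein)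
    (hu₁ : normSq u = 1) (hv₁ : normSq v = 1) : Generated (M !![u, 0; 0, v]) := by
  have key : ∀ k : ℕ, Generated (M !![(-ω) ^ k, 0; 0, 1]) := by
    intro k
    rw [← U₂_pow]
    induction k with
    | zero => rw [pow_zero, M_one]; exact .one
    | succ k ih => rw [pow_succ, ← M_mul]; exact ih.mul generated_M_U₂
  obtain ⟨k, rfl⟩ := exists_eq_neg_omega_pow hu hu₁
  obtain ⟨l, rfl⟩ := exists_eq_neg_omega_pow hv hv₁
  have h := (key k).mul ((generated_M_U₁.mul (key l)).mul generated_M_U₁)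
  rw [M_mul, M_mul, M_mul] at h
  convert h using 2
  simp [U₁]

theorem generated_M_antidiagonal {u v : ℂ} (hu : u ∈ eisenstein) (hv : v ∈ eisenstein)
    (hu₁ : normSq u = 1) (hv₁ : normSq v = 1) : Generated (M !![0, u; v, 0]) := by
  have h := (generated_M_diagonal hu hv hu₁ hv₁).mul generated_M_U₁
  rw [M_mul] at h
  convert h using 2
  simp [U₁]

/-- The translation parts of the generated Heisenberg translations. -/
def translations : AddSubgroup (ℂ × ℂ) where
  carrier := {p | ∃ z, Generated (heis p.1 p.2 z)}
  zero_mem' := ⟨0, by simpa [heis_zero] using Generated.one⟩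
  add_mem' := by
    rintro p q ⟨z, hz⟩ ⟨w, hw⟩
    exact ⟨_, heis_mul .. ▸ hz.mul hw⟩
  neg_mem' := by
    rintro p ⟨z, hz⟩
    refine ⟨-z - conj p.1 * p.1 - conj p.2 * p.2, hz.of_mul_left ?_⟩
    convert Generated.one
    rw [heis_mul, ← heis_zero]
    congr 1
    · simp
    · simp
    · simp
      ring

theorem generated_heis_neg_omega : Generated (heis (-ω) 0 ω) := by
  refine generated_M_U₂.of_mul_right ?_
  have h : M U₂ * heis 1 0 ω = heis (-ω) 0 ω * M U₂ := by
    ext i j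
    fin_cases i <;> fin_cases j <;>
      simp [heis, M, U₂, Matrix.mul_apply, Fin.sum_univ_four, conj_omega]
    linear_combination omega_mul_self
  exact h ▸ generated_M_U₂.mul generated_heis_one

theorem generated_heis_swap {a b z : ℂ} (h : Generated (heis a b z)) :
    Generated (heis b a z) := by
  refine generated_M_U₁.of_mul_right ?_
  have h' : M U₁ * heis a b z = heis b a z * M U₁ := by
    ext i j
    fin_cases i <;> fin_cases j <;>
      simp [heis, M, U₁, Matrix.mul_apply, Fin.sum_univ_four]
  exact h' ▸ generated_M_U₁.mul h

theorem exists_generated_heis {a b : ℂ} (ha : a ∈ eisenstein) (hb : b ∈ eisenstein) :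
    ∃ z, Generated (heis a b z) := by
  obtain ⟨m, n, rfl⟩ := ha
  obtain ⟨k, l, rfl⟩ := hb
  have h₁ : ((1, 0) : ℂ × ℂ) ∈ translations := ⟨ω, generated_heis_one⟩
  have h₂ : ((-ω, 0) : ℂ × ℂ) ∈ translations := ⟨ω, generated_heis_neg_omega⟩
  have h₃ : ((0, 1) : ℂ × ℂ) ∈ translations := ⟨ω, generated_heis_swap generated_heis_one⟩
  have h₄ : ((0, -ω) : ℂ × ℂ) ∈ translations :=
    ⟨ω, generated_heis_swap generated_heis_neg_omega⟩
  have h := add_mem (sub_mem (zsmul_mem h₁ m) (zsmul_mem h₂ n))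
    (sub_mem (zsmul_mem h₃ k) (zsmul_mem h₄ l))
  have : ((m + n * ω, k + l * ω) : ℂ × ℂ) ∈ translations := by
    convert h using 1
    simp
  exact this

theorem generated_heis_vertical (k : ℤ) : Generated (heis 0 0 (k • (2 * ω + 1))) := by
  have h₁ : Generated (heis 0 0 (2 * ω + 1)) := by
    refine (generated_heis_neg_omega.mul generated_heis_one).of_mul_right ?_
    convert generated_heis_one.mul generated_heis_neg_omega using 1
    simp only [heis_mul]
    congr 1
    · ring
    · ring
    · simp only [map_neg, map_zero, map_one, conj_omega]
      ring
  have heis_add : ∀ z w, heis 0 0 z * heis 0 0 w = heis 0 0 (z + w) := by simp [heis_mul]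
  induction k using Int.induction_on with
  | zero => simpa [heis_zero] using Generated.one
  | succ k ih =>
    rw [add_smul, one_smul, ← heis_add]
    exact ih.mul h₁
  | pred k ih =>
    refine h₁.of_mul_right ?_
    rwa [heis_add, sub_smul, one_smul, sub_add_cancel]

/-! ### The stabilizer of infinity -/

theorem conj_mul_self_eq (z : ℂ) : conj z * z = (normSq z : ℂ) := by
  rw [mul_comm, mul_conj]

theorem generated_M_of_form {U : Matrix (Fin 2) (Fin 2) ℂ} (hU : ∀ i j, U i j ∈ eisenstein)
    (h : ∀ i j, conj (U 0 i) * U 0 j + conj (U 1 i) * U 1 j = if i = j then 1 else 0) :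
    Generated (M U) := by
  have h₀ : normSq (U 0 0) + normSq (U 1 0) = 1 := by
    have := h 0 0
    rw [if_pos rfl, conj_mul_self_eq, conj_mul_self_eq] at this
    exact_mod_cast this
  have h₁ : normSq (U 0 1) + normSq (U 1 1) = 1 := by
    have := h 1 1
    rw [if_pos rfl, conj_mul_self_eq, conj_mul_self_eq] at this
    exact_mod_cast this
  have h₀₁ : conj (U 0 0) * U 0 1 + conj (U 1 0) * U 1 1 = 0 := h 0 1
  rw [Matrix.eta_fin_two U]
  rcases normSq_eq_zero_or_one (hU 0 0) (hU 1 0) h₀ with ⟨h₂, h₃⟩ | ⟨h₃, h₂⟩ <;>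
  rcases normSq_eq_zero_or_one (hU 0 1) (hU 1 1) h₁ with ⟨h₄, h₅⟩ | ⟨h₅, h₄⟩
  · have : U 1 0 ≠ 0 := by rintro h; simp [h] at h₃
    have : U 1 1 ≠ 0 := by rintro h; simp [h] at h₅
    simp_all
  · rw [h₂, h₄]
    exact generated_M_antidiagonal (hU _ _) (hU _ _) h₅ h₃
  · rw [h₂, h₄]
    exact generated_M_diagonal (hU _ _) (hU _ _) h₃ h₅
  · have : U 0 0 ≠ 0 := by rintro h; simp [h] at h₃
    have : U 0 1 ≠ 0 := by rintro h; simp [h] at h₅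
    simp_all

theorem IsPicard.column_zero {A : Matrix (Fin 4) (Fin 4) ℂ} (hA : IsPicard A)
    (h : A 3 0 = 0) : A 1 0 = 0 ∧ A 2 0 = 0 := by
  have h₀ := hA.form_apply 0 0
  simp only [h, Jm, map_zero, mul_zero, zero_mul, add_zero, zero_add, conj_mul_self_eq] at h₀
  have h₁ : normSq (A 1 0) + normSq (A 2 0) = 0 := by
    exact_mod_cast h₀.trans (show _ = (0 : ℂ) by simp)
  constructor <;> rw [← normSq_eq_zero] <;> linarith [normSq_nonneg (A 1 0), normSq_nonneg (A 2 0)]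

theorem IsPicard.conj_mul_row_three {A : Matrix (Fin 4) (Fin 4) ℂ} (hA : IsPicard A)
    (h : A 3 0 = 0) (j : Fin 4) : conj (A 0 0) * A 3 j = Jm 0 j := by
  obtain ⟨h₁, h₂⟩ := hA.column_zero h
  have := hA.form_apply 0 j
  simpa [h, h₁, h₂] using this

theorem generated_of_corners_eq_one_of_column_three {A : Matrix (Fin 4) (Fin 4) ℂ}
    (hA : IsPicard A) (h : A 3 0 = 0) (h₀ : A 0 0 = 1) (h₁₃ : A 1 3 = 0) (h₂₃ : A 2 3 = 0) :
    Generated A := by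
  obtain ⟨h₁₀, h₂₀⟩ := hA.column_zero h
  have row (j) : A 3 j = Jm 0 j := by simpa [h₀] using hA.conj_mul_row_three h j
  have h₃₁ : A 3 1 = 0 := by simp [row, Jm]
  have h₃₂ : A 3 2 = 0 := by simp [row, Jm]
  have h₃₃ : A 3 3 = 1 := by simp [row, Jm]
  have h₀₁ : A 0 1 = 0 := by
    have := hA.form_apply 3 1
    simpa [h₃₁, h₁₃, h₂₃, h₃₃, Jm] using this
  have h₀₂ : A 0 2 = 0 := by
    have := hA.form_apply 3 2
    simpa [h₃₂, h₁₃, h₂₃, h₃₃, Jm] using this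
  obtain ⟨k, hk⟩ : ∃ k : ℤ, A 0 3 = k • (2 * ω + 1) := by
    refine eq_zsmul_of_add_conj_eq_zero (hA.2 0 3) ?_
    have := hA.form_apply 3 3
    simpa [h₁₃, h₂₃, h₃₃, Jm, add_comm] using this
  have hU : Generated (M !![A 1 1, A 1 2; A 2 1, A 2 2]) := by
    apply generated_M_of_form
    · intro i j
      fin_cases i <;> fin_cases j <;> exact hA.2 _ _
    · intro i j
      fin_cases i <;> fin_cases j
      · simpa [h₃₁, Jm] using hA.form_apply 1 1
      · simpa [h₃₁, h₃₂, Jm] using hA.form_apply 1 2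
      · simpa [h₃₁, h₃₂, Jm] using hA.form_apply 2 1
      · simpa [h₃₂, Jm] using hA.form_apply 2 2
  convert (generated_heis_vertical k).mul hU using 1
  rw [← hk]
  ext i j
  fin_cases i <;> fin_cases j <;> simp [heis, M, Matrix.mul_apply, Fin.sum_univ_four, h, h₀, h₁₃, h₂₃,
    h₁₀, h₂₀, h₃₁, h₃₂, h₃₃, h₀₁, h₀₂]

theorem generated_of_corners_eq_one {A : Matrix (Fin 4) (Fin 4) ℂ} (hA : IsPicard A)
    (h : A 3 0 = 0) (h₀ : A 0 0 = 1) : Generated A := by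
  obtain ⟨h₁₀, h₂₀⟩ := hA.column_zero h
  have h₃₃ : A 3 3 = 1 := by simpa [h₀, Jm] using hA.conj_mul_row_three h 3
  obtain ⟨z, hz⟩ := exists_generated_heis (neg_mem (hA.2 1 3)) (neg_mem (hA.2 2 3))
  refine hz.of_mul_left (generated_of_corners_eq_one_of_column_three (hz.isPicard.mul hA) ?_ ?_
    ?_ ?_) <;> simp [heis, Matrix.mul_apply, Fin.sum_univ_four, *]

theorem exists_generated_smul_of_stabilizer {A : Matrix (Fin 4) (Fin 4) ℂ} (hA : IsPicard A)
    (h : A 3 0 = 0) : ∃ u : ℂ, u ^ 6 = 1 ∧ Generated (u • A) := by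
  have h₀₃ : conj (A 0 0) * A 3 3 = 1 := by simpa [Jm] using hA.conj_mul_row_three h 3
  have h₁ : normSq (A 0 0) = 1 := by
    obtain ⟨m, hm⟩ := exists_nat_normSq_eq (hA.2 0 0)
    obtain ⟨n, hn⟩ := exists_nat_normSq_eq (hA.2 3 3)
    have := congrArg normSq h₀₃
    rw [normSq_mul, normSq_conj, hm, hn, normSq_one] at this
    rw [hm]
    exact_mod_cast Nat.eq_one_of_mul_eq_one_right (by exact_mod_cast this)
  have h₂ : conj (A 0 0) * A 0 0 = 1 := by rw [conj_mul_self_eq, h₁, ofReal_one]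
  have hu := conj_mem_eisenstein (hA.2 0 0)
  refine ⟨conj (A 0 0), ?_, generated_of_corners_eq_one (hA.smul hu ?_) ?_ ?_⟩
  · obtain ⟨k, hk⟩ := exists_eq_neg_omega_pow hu ((normSq_conj _).trans h₁)
    rw [hk, ← pow_mul, mul_comm, pow_mul, neg_omega_pow_six, one_pow]
  · rw [conj_conj, mul_comm, h₂]
  · simp [h]
  · simpa using h₂

/-! ### Reduction to the stabilizer of infinity -/

theorem exists_generated_normSq_lt {A : Matrix (Fin 4) (Fin 4) ℂ} (hA : IsPicard A)
    (h : A 3 0 ≠ 0) :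
    ∃ B, Generated B ∧ normSq ((B * A) 3 0) < normSq (A 3 0) := by
  obtain ⟨a, ha, ha'⟩ := exists_normSq_add_le (A 1 0 / A 3 0)
  obtain ⟨b, hb, hb'⟩ := exists_normSq_add_le (A 2 0 / A 3 0)
  obtain ⟨z, hz⟩ := exists_generated_heis ha hb
  set C := heis a b z * A with hC
  have hCp : IsPicard C := hz.isPicard.mul hA
  set c := A 3 0 with hc
  have h₁ : C 1 0 = (A 1 0 / c + a) * c := by
    rw [add_mul, div_mul_cancel₀ _ h]
    rw [hC, Matrix.mul_apply, Fin.sum_univ_four]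
    simp [heis, hc]
  have h₂ : C 2 0 = (A 2 0 / c + b) * c := by
    rw [add_mul, div_mul_cancel₀ _ h]
    rw [hC, Matrix.mul_apply, Fin.sum_univ_four]
    simp [heis, hc]
  have h₃ : C 3 0 = c := by
    rw [hC, Matrix.mul_apply, Fin.sum_univ_four]
    simp [heis, hc]
  obtain ⟨q, hq⟩ : ∃ q, C 0 0 = q * c := ⟨C 0 0 / c, (div_mul_cancel₀ _ h).symm⟩
  have hcpos : 0 < normSq c := normSq_pos.2 h
  have hform : 2 * q.re + normSq (A 1 0 / c + a) + normSq (A 2 0 / c + b) = 0 := by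
    have h₀ := hCp.form_apply 0 0
    rw [hq, h₁, h₂, h₃] at h₀
    have h₄ : ((2 * q.re + normSq (A 1 0 / c + a) + normSq (A 2 0 / c + b) : ℝ) : ℂ) *
        (normSq c : ℂ) = 0 := by
      push_cast
      rw [← conj_mul_self_eq, ← conj_mul_self_eq, ← conj_mul_self_eq, ← ofReal_ofNat 2,
        ← ofReal_mul, ← add_conj]
      have hJ : Jm 0 0 = 0 := by simp [Jm]
      simp only [map_mul, hJ] at h₀
      linear_combination h₀
    rcases mul_eq_zero.1 h₄ with h₄ | h₄
    · exact_mod_cast h₄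
    · exact absurd (by exact_mod_cast h₄) hcpos.ne'
  obtain ⟨k, hk⟩ := exists_normSq_add_zsmul_lt (w := q) (by
    rw [abs_le]
    constructor <;>
      linarith [normSq_nonneg (A 1 0 / c + a), normSq_nonneg (A 2 0 / c + b)])
  refine ⟨Rmat * heis 0 0 (k • (2 * ω + 1)) * heis a b z,
    (generated_Rmat.mul (generated_heis_vertical k)).mul hz, ?_⟩
  have h₅ : (Rmat * heis 0 0 (k • (2 * ω + 1)) * heis a b z * A) 3 0
      = (q + k • (2 * ω + 1)) * c := by
    rw [Matrix.mul_assoc, ← hC, add_mul, ← hq, Matrix.mul_apply, Fin.sum_univ_four, h₃]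
    simp [Rmat, heis, Matrix.mul_apply, Fin.sum_univ_four]
  rw [h₅, normSq_mul]
  exact mul_lt_of_lt_one_left hcpos hk

theorem exists_generated_smul {A : Matrix (Fin 4) (Fin 4) ℂ} (hA : IsPicard A) :
    ∃ u : ℂ, u ^ 6 = 1 ∧ Generated (u • A) := by
  obtain ⟨n, hn⟩ := exists_nat_normSq_eq (hA.2 3 0)
  induction n using Nat.strong_induction_on generalizing A with
  | _ n ih =>
    by_cases h : A 3 0 = 0
    · exact exists_generated_smul_of_stabilizer hA h
    · obtain ⟨B, hB, hlt⟩ := exists_generated_normSq_lt hA h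
      have hBA := hB.isPicard.mul hA
      obtain ⟨m, hm⟩ := exists_nat_normSq_eq (hBA.2 3 0)
      rw [hm, hn] at hlt
      obtain ⟨u, hu, hgen⟩ := ih m (by exact_mod_cast hlt) hBA hm
      exact ⟨u, hu, hB.of_mul_left (by rwa [Matrix.mul_smul])⟩

/-- Main theorem: every element of the Eisenstein–Picard modular group U(3,1; Z[ω]) is,
up to a sixth-root-of-unity scalar, a product of the four generators N₁, M_{U₁}, M_{U₂}, R. -/
theorem stmt13 (G : Matrix (Fin 4) (Fin 4) ℂ) (hG : Gᴴ * Jm * G = Jm)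
    (hent : ∀ i j, G i j ∈ Zω) :
    ∃ lam : ℂ, lam ^ 6 = 1 ∧
      ∃ g ∈ Subgroup.closure gens4, (g : Matrix (Fin 4) (Fin 4) ℂ) = lam • G := by
  exact exists_generated_smul ⟨hG, hent⟩
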